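/- arXiv:1804.09628 — 2 statements merged into one kernel-verified Lean document; each statement's English description precedes it below -/
import Mathlib

section
/- Let q be a prime power, K a finite field with q elements, K̄ an algebraic closure of K, and φ the Frobenius map on P¹(K̄) given by [a : b] ↦ [a^q : b^q]. The number of orbits of the componentwise action of PGL₂(K) on the set of ordered 6-tuples (x₁, …, x₆) of pairwise distinct points of P¹(K̄) satisfying φ(x₁) = x₂, φ(x₂) = x₃, φ(x₃) = x₁, φ(x₄) = x₅, φ(x₅) = x₄ and φ(x₆) = x₆ equals q³ − q. -/
open Projectivization

/-! ## The projective line and the actions of `GL₂` and `PGL₂` -/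

/-- `GL₂(L)` as a group of linear automorphisms of `L²`. -/
noncomputable def glMulEquiv (L : Type*) [Field L] :
    GL (Fin 2) L ≃* ((Fin 2 → L) ≃ₗ[L] (Fin 2 → L)) :=
  (Matrix.GeneralLinearGroup.toLin).trans
    (LinearMap.GeneralLinearGroup.generalLinearEquiv L (Fin 2 → L))

theorem glMulEquiv_apply (L : Type*) [Field L] (g : GL (Fin 2) L) (v : Fin 2 → L) :
    glMulEquiv L g v = (g : Matrix (Fin 2) (Fin 2) L).mulVec v := by
  simp [glMulEquiv]

/-- The action of `GL₂(L)` on the projective line `P¹(L)`, given in homogeneous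
coordinates by `[a : b] ↦ [α a + β b : γ a + δ b]`. -/
noncomputable def glP1 (L : Type*) [Field L] :
    GL (Fin 2) L →* Function.End (Projectivization L (Fin 2 → L)) where
  toFun g := Projectivization.map (glMulEquiv L g).toLinearMap (glMulEquiv L g).injective
  map_one' := by
    funext x
    induction x using Projectivization.ind with
    | h v hv =>
      show Projectivization.map (glMulEquiv L 1).toLinearMap (glMulEquiv L 1).injective
          (Projectivization.mk L v hv) = Projectivization.mk L v hv
      rw [Projectivization.map_mk, Projectivization.mk_eq_mk_iff']
      exact ⟨1, by simp [glMulEquiv_apply]⟩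
  map_mul' g h := by
    funext x
    induction x using Projectivization.ind with
    | h v hv =>
      show Projectivization.map (glMulEquiv L (g * h)).toLinearMap
          (glMulEquiv L (g * h)).injective (Projectivization.mk L v hv)
        = Projectivization.map (glMulEquiv L g).toLinearMap (glMulEquiv L g).injective
            (Projectivization.map (glMulEquiv L h).toLinearMap (glMulEquiv L h).injective
              (Projectivization.mk L v hv))
      rw [Projectivization.map_mk, Projectivization.map_mk, Projectivization.map_mk,
        Projectivization.mk_eq_mk_iff']
      exact ⟨1, by simp [glMulEquiv_apply, Matrix.mulVec_mulVec]⟩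

/-- The action of `GL₂(L)` on `P¹(L)` as a `MulAction`. -/
noncomputable instance glP1Action (L : Type*) [Field L] :
    MulAction (GL (Fin 2) L) (Projectivization L (Fin 2 → L)) :=
  MulAction.ofEndHom (glP1 L)

/-- The subgroup of scalar matrices inside `GL₂(L)`. -/
def scalarSubgroup (L : Type*) [Field L] : Subgroup (GL (Fin 2) L) :=
  (Units.map ((Matrix.scalar (Fin 2)) : L →+* Matrix (Fin 2) (Fin 2) L).toMonoidHom).range

instance scalarSubgroup_normal (L : Type*) [Field L] : (scalarSubgroup L).Normal := by
  constructor
  rintro n ⟨a, rfl⟩ g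
  refine ⟨a, ?_⟩
  have hc : Commute (Units.map ((Matrix.scalar (Fin 2)) :
      L →+* Matrix (Fin 2) (Fin 2) L).toMonoidHom a) g := by
    apply Units.ext
    simpa using (Matrix.scalar_commute (a : L) (fun r => mul_comm _ _)
      (g : Matrix (Fin 2) (Fin 2) L)).eq
  rw [← hc.eq, mul_assoc, mul_inv_cancel, mul_one]

/-- `PGL₂(K)`: the quotient of `GL₂(K)` by the subgroup of scalar matrices. -/
abbrev PGL2 (K : Type*) [Field K] := GL (Fin 2) K ⧸ scalarSubgroup K

/-- Scalar matrices act trivially on the projective line. -/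
theorem glP1_scalar_eq_one (L : Type*) [Field L] (a : Lˣ) :
    glP1 L (Units.map ((Matrix.scalar (Fin 2)) :
      L →+* Matrix (Fin 2) (Fin 2) L).toMonoidHom a) = 1 := by
  set u := Units.map ((Matrix.scalar (Fin 2)) :
      L →+* Matrix (Fin 2) (Fin 2) L).toMonoidHom a with hu
  funext x
  induction x using Projectivization.ind with
  | h v hv =>
    show Projectivization.map (glMulEquiv L u).toLinearMap (glMulEquiv L u).injective
        (Projectivization.mk L v hv) = Projectivization.mk L v hv
    rw [Projectivization.map_mk, Projectivization.mk_eq_mk_iff']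
    refine ⟨(a : L), ?_⟩
    simp [glMulEquiv_apply, hu, Matrix.scalar_apply, Matrix.diagonal_const_mulVec]

/-- For a field homomorphism `f : K →+* L`, the scalar matrices of `GL₂(K)` act trivially on
`P¹(L)`, hence the action of `GL₂(K)` on `P¹(L)` descends to an action of `PGL₂(K)`. -/
noncomputable def pglP1 {K L : Type*} [Field K] [Field L] (f : K →+* L) :
    PGL2 K →* Function.End (Projectivization L (Fin 2 → L)) :=
  QuotientGroup.lift (scalarSubgroup K)
    ((glP1 L).comp (Matrix.GeneralLinearGroup.map f))
    (by
      rintro z ⟨a, rfl⟩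
      have key : Matrix.GeneralLinearGroup.map (n := Fin 2) f
          (Units.map ((Matrix.scalar (Fin 2)) : K →+* Matrix (Fin 2) (Fin 2) K).toMonoidHom a)
          = Units.map ((Matrix.scalar (Fin 2)) :
              L →+* Matrix (Fin 2) (Fin 2) L).toMonoidHom (Units.map f.toMonoidHom a) := by
        apply Units.ext
        ext i j
        simp [Matrix.GeneralLinearGroup.map, Matrix.scalar_apply, Matrix.diagonal,
          Matrix.map_apply, apply_ite f]
      rw [MonoidHom.mem_ker, MonoidHom.comp_apply, key, glP1_scalar_eq_one])

/-- The action of `PGL₂(K)` on `P¹(L)`, for any extension `L` of `K` via `f : K →+* L`. -/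
noncomputable def pglP1Action {K L : Type*} [Field K] [Field L] (f : K →+* L) :
    MulAction (PGL2 K) (Projectivization L (Fin 2 → L)) :=
  MulAction.ofEndHom (pglP1 f)
/-- The Frobenius map on the projective line `P¹(L)`, acting in homogeneous coordinates by
`[a : b] ↦ [a ^ q : b ^ q]`. -/
noncomputable def frobP1 {L : Type*} [Field L] (q : ℕ)
    (x : Projectivization L (Fin 2 → L)) : Projectivization L (Fin 2 → L) :=
  Projectivization.mk L (fun i => (x.rep i) ^ q) (by
    intro hzero
    obtain ⟨i, hi⟩ := Function.ne_iff.mp x.rep_nonzero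
    have h2 : x.rep i ^ q = 0 := congrFun hzero i
    exact hi (by simpa using (pow_eq_zero_iff'.mp h2).1))

noncomputable instance pglP1ClosureAction (K : Type*) [Field K] :
    MulAction (PGL2 K)
      (Projectivization (AlgebraicClosure K) (Fin 2 → AlgebraicClosure K)) :=
  pglP1Action (algebraMap K (AlgebraicClosure K))

/-! ## Counting orbits of a free action -/

theorem card_eq_card_mul_card_orbits_of_free {G Y : Type*} [Group G] [MulAction G Y]
    (S : Y → Prop) (hS : ∀ (g : G) y, S y → S (g • y))
    (hfree : ∀ (g : G) y, S y → g • y = y → g = 1) :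
    Nat.card {y // S y} = Nat.card G *
      Nat.card (Quotient (Setoid.comap (Subtype.val : {y // S y} → Y)
        (MulAction.orbitRel G Y))) := by
  rw [← Nat.card_prod]
  symm
  refine Nat.card_eq_of_bijective
    (fun p => (⟨p.1 • p.2.out.1, hS _ _ p.2.out.2⟩ : {y // S y})) ⟨?_, ?_⟩
  · rintro ⟨g, a⟩ ⟨h, b⟩ hab
    have e : g • a.out.1 = h • b.out.1 := congrArg Subtype.val hab
    have key : a = b := by
      rw [← a.out_eq, ← b.out_eq]
      refine Quotient.sound ?_
      show MulAction.orbitRel G Y a.out.1 b.out.1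
      rw [MulAction.orbitRel_apply]
      exact ⟨g⁻¹ * h, by simp [mul_smul, ← e]⟩
    subst key
    have := hfree (h⁻¹ * g) a.out.1 a.out.2 (by simp [mul_smul, e])
    rw [inv_mul_eq_one] at this
    rw [this]
  · intro y
    have h : MulAction.orbitRel G Y
        (Quotient.mk (Setoid.comap (Subtype.val : {y // S y} → Y)
          (MulAction.orbitRel G Y)) y).out.1 y.1 :=
      Quotient.mk_out (s := Setoid.comap (Subtype.val : {y // S y} → Y)
          (MulAction.orbitRel G Y)) y
    obtain ⟨g, hg⟩ := MulAction.orbitRel_apply.1 (Setoid.symm' _ h)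
    exact ⟨⟨g, _⟩, Subtype.ext hg⟩

/-! ## Tuples of prescribed cycle type -/

/-- An injective tuple on which `f` acts as a product of a 3-cycle, a 2-cycle and a fixed point. -/
def IsCycleTuple {α : Type*} (f : α → α) (x : Fin 6 → α) : Prop :=
  Function.Injective x ∧ f (x 0) = x 1 ∧ f (x 1) = x 2 ∧ f (x 2) = x 0 ∧
    f (x 3) = x 4 ∧ f (x 4) = x 3 ∧ f (x 5) = x 5

theorem IsCycleTuple.comp {α : Type*} {f g : α → α} {x : Fin 6 → α} (hx : IsCycleTuple f x)
    (hg : Function.Injective g) (hfg : ∀ a, f (g a) = g (f a)) : IsCycleTuple f (g ∘ x) := by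
  obtain ⟨hi, h⟩ := hx
  exact ⟨hg.comp hi, by simpa only [Function.comp_apply, hfg, hg.eq_iff] using h⟩

theorem card_isCycleTuple {α : Type*} (f : α → α) :
    Nat.card {x // IsCycleTuple f x} =
      Nat.card {a // f (f (f a)) = a ∧ f a ≠ a} *
        (Nat.card {a // f (f a) = a ∧ f a ≠ a} * Nat.card {a // f a = a}) := by
  rw [← Nat.card_prod, ← Nat.card_prod]
  refine Nat.card_congr
    { toFun := fun x => (⟨x.1 0, ?_⟩, ⟨x.1 3, ?_⟩, ⟨x.1 5, x.2.2.2.2.2.2.2⟩)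
      invFun := fun p => ⟨![p.1, f p.1, f (f p.1), p.2.1, f p.2.1, p.2.2], ?_⟩
      left_inv := ?_
      right_inv := fun p => rfl }
  · obtain ⟨x, hi, h0, h1, h2, h3, h4, h5⟩ := x
    simp [h0, h1, h2, hi.eq_iff]
  · obtain ⟨x, hi, h0, h1, h2, h3, h4, h5⟩ := x
    simp [h3, h4, hi.eq_iff]
  · obtain ⟨⟨a, ha, ha'⟩, ⟨b, hb, hb'⟩, ⟨c, hc⟩⟩ := p
    refine ⟨?_, by simp [ha, hb, hc]⟩
    intro i j hij
    fin_cases i <;> fin_cases j <;> simp at hij ⊢ <;> grind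
  · rintro ⟨x, hi, h0, h1, h2, h3, h4, h5⟩
    ext i
    fin_cases i <;> simp [h0, h1, h3]

/-! ## The projective line as the affine line with a point at infinity -/

/-- The affine coordinate on `P¹(L)`: `a ↦ [a : 1]` and `∞ ↦ [1 : 0]`. -/
def optionToP1 (L : Type*) [Field L] : Option L → Projectivization L (Fin 2 → L)
  | none => Projectivization.mk L ![1, 0] (by simp)
  | some a => Projectivization.mk L ![a, 1] (by simp)

theorem optionToP1_bijective (L : Type*) [Field L] : Function.Bijective (optionToP1 L) := by
  constructor
  · rintro (_ | a) (_ | b) h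
    · rfl
    · rw [optionToP1, optionToP1, Projectivization.mk_eq_mk_iff'] at h
      obtain ⟨c, hc⟩ := h
      have h0 := congrFun hc 0
      have h1 := congrFun hc 1
      simp_all
    · rw [optionToP1, optionToP1, Projectivization.mk_eq_mk_iff'] at h
      obtain ⟨c, hc⟩ := h
      simp_all
    · rw [optionToP1, optionToP1, Projectivization.mk_eq_mk_iff'] at h
      obtain ⟨c, hc⟩ := h
      have h0 := congrFun hc 0
      have h1 := congrFun hc 1
      simp_all
  · intro x
    induction x using Projectivization.ind with
    | h v hv =>
      by_cases h1 : v 1 = 0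
      · refine ⟨none, ?_⟩
        have h0 : v 0 ≠ 0 := fun h0 => hv (by ext i; fin_cases i <;> simp [h0, h1])
        rw [optionToP1, Projectivization.mk_eq_mk_iff']
        exact ⟨(v 0)⁻¹, by ext i; fin_cases i <;> simp [h0, h1]⟩
      · refine ⟨some (v 0 / v 1), ?_⟩
        rw [optionToP1, Projectivization.mk_eq_mk_iff']
        exact ⟨(v 1)⁻¹, by ext i; fin_cases i <;> simp [h1]; field_simp⟩

theorem frobP1_mk {L : Type*} [Field L] (q : ℕ) (v : Fin 2 → L) (hv : v ≠ 0)
    (hv' : (fun i => v i ^ q) ≠ 0) :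
    frobP1 q (Projectivization.mk L v hv) = Projectivization.mk L (fun i => v i ^ q) hv' := by
  obtain ⟨c, hc⟩ := Projectivization.exists_smul_eq_mk_rep L v hv
  rw [frobP1, Projectivization.mk_eq_mk_iff']
  refine ⟨(c : L) ^ q, ?_⟩
  ext i
  simp [← hc, Units.smul_def, mul_pow]

theorem frobP1_optionToP1 {L : Type*} [Field L] {q : ℕ} (hq : q ≠ 0) (a : Option L) :
    frobP1 q (optionToP1 L a) = optionToP1 L (a.map (· ^ q)) := by
  cases a with
  | none =>
    have e : (fun i => (![1, 0] : Fin 2 → L) i ^ q) = ![1, 0] := by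
      ext i; fin_cases i <;> simp [hq]
    rw [optionToP1, frobP1_mk _ _ _ (by simp [e])]
    simp [e, optionToP1]
  | some a =>
    have e : (fun i => (![a, 1] : Fin 2 → L) i ^ q) = ![a ^ q, 1] := by
      ext i; fin_cases i <;> simp
    rw [optionToP1, frobP1_mk _ _ _ (by simp [e])]
    simp [e, optionToP1]

/-! ## Counting points of given degree over a finite field -/

section Count

variable {K : Type*} [Field K] [Fintype K]

theorem ncard_pow_card_pow_eq_self {n : ℕ} (hn : n ≠ 0) :
    {a : AlgebraicClosure K | a ^ Fintype.card K ^ n = a}.ncard = Fintype.card K ^ n := by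
  classical
  obtain ⟨p, hp⟩ := CharP.exists K
  have := Fact.mk (CharP.char_is_prime K p)
  have : CharP (AlgebraicClosure K) p := charP_of_injective_algebraMap' K p
  have hc := Fintype.one_lt_card (α := K)
  have hq : 1 < Fintype.card K ^ n := Nat.one_lt_pow hn hc
  have hpq : p ∣ Fintype.card K ^ n :=
    dvd_pow (CharP.cast_eq_zero_iff K p _ |>.1 (FiniteField.cast_card_eq_zero K)) hn
  have hsep : (Polynomial.X ^ Fintype.card K ^ n - Polynomial.X :
      Polynomial (AlgebraicClosure K)).Separable := galois_poly_separable p _ hpq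
  have hdeg := FiniteField.X_pow_card_sub_X_natDegree_eq (AlgebraicClosure K) hq
  have hne := FiniteField.X_pow_card_sub_X_ne_zero (AlgebraicClosure K) hq
  have hcard := Polynomial.card_rootSet_eq_natDegree hsep
    (IsAlgClosed.splits (k := AlgebraicClosure K) _)
  rw [hdeg, ← Nat.card_eq_fintype_card, Nat.card_coe_set_eq] at hcard
  refine Eq.trans (congrArg Set.ncard ?_) hcard
  ext a
  simp [Polynomial.mem_rootSet, hne, sub_eq_zero]

theorem ncard_pow_card_pow_eq_self_and_ne {n : ℕ} (hn : n ≠ 0) :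
    {a : AlgebraicClosure K | a ^ Fintype.card K ^ n = a ∧ a ^ Fintype.card K ≠ a}.ncard =
      Fintype.card K ^ n - Fintype.card K := by
  have h1 : {a : AlgebraicClosure K | a ^ Fintype.card K = a}.ncard = Fintype.card K := by
    simpa using ncard_pow_card_pow_eq_self (K := K) one_ne_zero
  have hsub : {a : AlgebraicClosure K | a ^ Fintype.card K = a} ⊆
      {a | a ^ Fintype.card K ^ n = a} := fun a ha => by
    have := Function.IsFixedPt.iterate (f := (· ^ Fintype.card K)) ha n
    rwa [pow_iterate] at this
  have hfin : {a : AlgebraicClosure K | a ^ Fintype.card K = a}.Finite :=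
    Set.finite_of_ncard_ne_zero (by rw [h1]; exact Fintype.card_ne_zero)
  have h := Set.ncard_sdiff hsub hfin
  rw [ncard_pow_card_pow_eq_self hn, h1] at h
  exact h

theorem card_frobP1_iterate_eq_and_ne {n : ℕ} (hn : n ≠ 0) :
    Nat.card {x : Projectivization (AlgebraicClosure K) (Fin 2 → AlgebraicClosure K) //
      (frobP1 (Fintype.card K))^[n] x = x ∧ frobP1 (Fintype.card K) x ≠ x} =
      Fintype.card K ^ n - Fintype.card K := by
  have hb := optionToP1_bijective (AlgebraicClosure K)
  have hq : Fintype.card K ≠ 0 := Fintype.card_ne_zero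
  have hit (a : Option (AlgebraicClosure K)) :
      (frobP1 (Fintype.card K))^[n] (optionToP1 _ a) =
        optionToP1 _ (a.map (· ^ Fintype.card K ^ n)) := by
    have h : Function.Semiconj (optionToP1 (AlgebraicClosure K))
      (Option.map (· ^ Fintype.card K)) (frobP1 (Fintype.card K)) :=
      fun a => (frobP1_optionToP1 hq a).symm
    rw [← (h.iterate_right n).eq, ← pow_iterate]
    congr 1
    cases a with
    | none => exact Function.iterate_fixed rfl n
    | some a =>
      have h' : Function.Semiconj (some : AlgebraicClosure K → _) (· ^ Fintype.card K)
        (Option.map (· ^ Fintype.card K)) := fun a => rfl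
      exact ((h'.iterate_right n).eq a).symm
  rw [← ncard_pow_card_pow_eq_self_and_ne hn, ← Nat.card_coe_set_eq]
  symm
  refine Nat.card_eq_of_bijective (fun a => ⟨optionToP1 _ (some a.1), ?_⟩) ⟨?_, ?_⟩
  · rw [hit, frobP1_optionToP1 hq]
    rw [ne_eq, hb.1.eq_iff, hb.1.eq_iff, Option.map_some, Option.map_some, Option.some_inj,
      Option.some_inj]
    exact a.2
  · intro a b h
    simpa [hb.1.eq_iff, Subtype.ext_iff] using h
  · rintro ⟨x, hx⟩
    obtain ⟨a, rfl⟩ := hb.2 x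
    rw [hit, frobP1_optionToP1 hq, ne_eq, hb.1.eq_iff, hb.1.eq_iff] at hx
    cases a with
    | none => simp at hx
    | some a => exact ⟨⟨a, by simpa using hx⟩, rfl⟩

theorem card_frobP1_eq :
    Nat.card {x : Projectivization (AlgebraicClosure K) (Fin 2 → AlgebraicClosure K) //
      frobP1 (Fintype.card K) x = x} = Fintype.card K + 1 := by
  have hb := optionToP1_bijective (AlgebraicClosure K)
  have hq : Fintype.card K ≠ 0 := Fintype.card_ne_zero
  have h1 : {a : AlgebraicClosure K | a ^ Fintype.card K = a}.ncard = Fintype.card K := by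
    simpa using ncard_pow_card_pow_eq_self (K := K) one_ne_zero
  rw [← Nat.card_coe_set_eq] at h1
  have : Finite {a : AlgebraicClosure K | a ^ Fintype.card K = a} :=
    Nat.finite_of_card_ne_zero (by rw [h1]; exact hq)
  conv_rhs => rw [← h1]
  rw [← Finite.card_option]
  symm
  refine Nat.card_eq_of_bijective
    (fun a => ⟨optionToP1 _ (a.map Subtype.val), ?_⟩) ⟨?_, ?_⟩
  · rw [frobP1_optionToP1 hq]
    rcases a with _ | ⟨a, ha⟩
    · rfl
    · simpa [hb.1.eq_iff] using ha
  · intro a b h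
    exact Option.map_injective Subtype.val_injective (hb.1 (congrArg Subtype.val h))
  · rintro ⟨x, hx⟩
    obtain ⟨a, rfl⟩ := hb.2 x
    rw [frobP1_optionToP1 hq, hb.1.eq_iff] at hx
    cases a with
    | none => exact ⟨none, rfl⟩
    | some a => exact ⟨some ⟨a, by simpa using hx⟩, rfl⟩

end Count

/-! ## The action of `PGL₂(K)` -/

section Action

variable {K : Type*} [Field K]

theorem card_PGL2_mul [Fintype K] :
    Nat.card (PGL2 K) * (Fintype.card K - 1) =
      (Fintype.card K ^ 2 - 1) * (Fintype.card K ^ 2 - Fintype.card K) := by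
  classical
  have hs : Nat.card (scalarSubgroup K) = Fintype.card K - 1 := by
    rw [← Fintype.card_units, ← Nat.card_eq_fintype_card]
    refine (Nat.card_congr (MonoidHom.ofInjective ?_).toEquiv).symm
    intro a b h
    have := congrArg (fun u : GL (Fin 2) K => (u : Matrix (Fin 2) (Fin 2) K) 0 0) h
    exact Units.ext (by simpa using this)
  rw [← hs, ← Subgroup.card_eq_card_quotient_mul_card_subgroup, Matrix.card_GL_field]
  simp [Fin.prod_univ_two]

theorem PGL2_smul_mk (g : GL (Fin 2) K) (v : Fin 2 → AlgebraicClosure K) (hv : v ≠ 0)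
    (hv' : ((g : Matrix (Fin 2) (Fin 2) K).map (algebraMap K (AlgebraicClosure K))).mulVec v ≠ 0) :
    (QuotientGroup.mk g : PGL2 K) • Projectivization.mk (AlgebraicClosure K) v hv =
      Projectivization.mk (AlgebraicClosure K)
        (((g : Matrix (Fin 2) (Fin 2) K).map (algebraMap K (AlgebraicClosure K))).mulVec v) hv' := by
  let h := Matrix.GeneralLinearGroup.map (algebraMap K (AlgebraicClosure K)) g
  show Projectivization.map (glMulEquiv _ h).toLinearMap (glMulEquiv _ h).injective
    (Projectivization.mk _ v hv) = _
  rw [Projectivization.map_mk, Projectivization.mk_eq_mk_iff']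
  exact ⟨1, by simp [glMulEquiv_apply, h, Matrix.GeneralLinearGroup.map]⟩

theorem map_mulVec_ne_zero (g : GL (Fin 2) K) {v : Fin 2 → AlgebraicClosure K} (hv : v ≠ 0) :
    ((g : Matrix (Fin 2) (Fin 2) K).map (algebraMap K (AlgebraicClosure K))).mulVec v ≠ 0 := by
  intro h
  apply hv
  apply (glMulEquiv _ (Matrix.GeneralLinearGroup.map (algebraMap K (AlgebraicClosure K)) g)).injective
  rw [map_zero, glMulEquiv_apply]
  exact h

theorem frobP1_smul [Fintype K] (g : PGL2 K)
    (x : Projectivization (AlgebraicClosure K) (Fin 2 → AlgebraicClosure K)) :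
    frobP1 (Fintype.card K) (g • x) = g • frobP1 (Fintype.card K) x := by
  obtain ⟨g, rfl⟩ := QuotientGroup.mk_surjective g
  induction x using Projectivization.ind with
  | h v hv =>
    have hpow {w : Fin 2 → AlgebraicClosure K} (hw : w ≠ 0) :
        (fun i => w i ^ Fintype.card K) ≠ 0 := fun h =>
      hw (funext fun i => pow_eq_zero_iff Fintype.card_ne_zero |>.1 (congrFun h i))
    have hg := map_mulVec_ne_zero g hv
    rw [PGL2_smul_mk _ _ _ hg, frobP1_mk _ _ _ (hpow hg), frobP1_mk _ _ _ (hpow hv),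
      PGL2_smul_mk _ _ _ (map_mulVec_ne_zero g (hpow hv)), Projectivization.mk_eq_mk_iff']
    refine ⟨1, ?_⟩
    have hF (a : AlgebraicClosure K) :
        a ^ Fintype.card K = FiniteField.frobeniusAlgHom K (AlgebraicClosure K) a := rfl
    ext i
    simp only [hF, Matrix.mulVec, dotProduct, Matrix.map_apply, one_smul, map_sum, map_mul,
      AlgHom.commutes]

/-- An element of `PGL₂(K)` fixing three distinct affine points is trivial. -/
theorem PGL2_eq_one_of_smul_eq (g : PGL2 K) {t : Fin 3 → AlgebraicClosure K}
    (ht : Function.Injective t)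
    (h : ∀ i, g • optionToP1 _ (some (t i)) = optionToP1 _ (some (t i))) : g = 1 := by
  obtain ⟨g, rfl⟩ := QuotientGroup.mk_surjective g
  set a := algebraMap K (AlgebraicClosure K)
  have hquad (i) : a (g 1 0) * t i ^ 2 + (a (g 1 1) - a (g 0 0)) * t i - a (g 0 1) = 0 := by
    have := h i
    rw [optionToP1, PGL2_smul_mk _ _ _ (map_mulVec_ne_zero g (by simp)),
      Projectivization.mk_eq_mk_iff'] at this
    obtain ⟨c, hc⟩ := this
    have h0 := congrFun hc 0
    have h1 := congrFun hc 1
    simp [Matrix.mulVec, dotProduct, Fin.sum_univ_two] at h0 h1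
    linear_combination t i * (-h1) + h0
  have h01 : t 0 - t 1 ≠ 0 := sub_ne_zero.2 (ht.ne (by decide))
  have h02 : t 0 - t 2 ≠ 0 := sub_ne_zero.2 (ht.ne (by decide))
  have h12 : t 1 - t 2 ≠ 0 := sub_ne_zero.2 (ht.ne (by decide))
  have e1 : a (g 1 0) * (t 0 + t 1) + (a (g 1 1) - a (g 0 0)) = 0 :=
    mul_left_cancel₀ h01 (by linear_combination hquad 0 - hquad 1)
  have e2 : a (g 1 0) * (t 0 + t 2) + (a (g 1 1) - a (g 0 0)) = 0 :=
    mul_left_cancel₀ h02 (by linear_combination hquad 0 - hquad 2)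
  have c0 : a (g 1 0) = 0 := mul_left_cancel₀ h12 (by linear_combination e1 - e2)
  have d0 : a (g 1 1) = a (g 0 0) := by linear_combination e1 - (t 0 + t 1) * c0
  have b0 : a (g 0 1) = 0 := by
    linear_combination t 0 ^ 2 * c0 + t 0 * d0 - hquad 0
  have hc : g 1 0 = 0 := a.injective (by rw [c0, map_zero])
  have hd : g 1 1 = g 0 0 := a.injective d0
  have hb : g 0 1 = 0 := a.injective (by rw [b0, map_zero])
  rw [QuotientGroup.eq_one_iff]
  have hne : g 0 0 ≠ 0 := by
    intro h0
    have := g.det_ne_zero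
    rw [Matrix.det_fin_two] at this
    exact this (by simp [h0, hc])
  refine ⟨Units.mk0 (g 0 0) hne, ?_⟩
  ext i j
  fin_cases i <;> fin_cases j <;> simp [hc, hd, hb]

end Action

/-- the number of `PGL₂(K)`-orbits of injective 6-tuples on `P¹(K̄)`
satisfying the stated Frobenius conditions. -/
theorem statement8 (q : ℕ) (hq : IsPrimePow q)
    (K : Type*) [Field K] [Fintype K] (hK : Fintype.card K = q) :
    (Nat.card (Quotient (Setoid.comap
      (Subtype.val :
        {x : Fin 6 → Projectivization (AlgebraicClosure K) (Fin 2 → AlgebraicClosure K) //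
          Function.Injective x ∧
          frobP1 q (x 0) = x 1 ∧
          frobP1 q (x 1) = x 2 ∧
          frobP1 q (x 2) = x 0 ∧
          frobP1 q (x 3) = x 4 ∧
          frobP1 q (x 4) = x 3 ∧
          frobP1 q (x 5) = x 5} →
        (Fin 6 → Projectivization (AlgebraicClosure K) (Fin 2 → AlgebraicClosure K)))
      (MulAction.orbitRel (PGL2 K)
        (Fin 6 → Projectivization (AlgebraicClosure K) (Fin 2 → AlgebraicClosure K))))) : ℤ)
    = (q : ℤ) ^ 3 - (q : ℤ) := by
  subst hK
  have hsmul : ∀ (g : PGL2 K)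
      (x : Fin 6 → Projectivization (AlgebraicClosure K) (Fin 2 → AlgebraicClosure K)),
      IsCycleTuple (frobP1 (Fintype.card K)) x →
      IsCycleTuple (frobP1 (Fintype.card K)) (g • x) := fun g x hx =>
    hx.comp (MulAction.injective g) (fun a => frobP1_smul g a)
  have hfree : ∀ (g : PGL2 K)
      (x : Fin 6 → Projectivization (AlgebraicClosure K) (Fin 2 → AlgebraicClosure K)),
      IsCycleTuple (frobP1 (Fintype.card K)) x →
      g • x = x → g = 1 := by
    rintro g x ⟨hi, h0, h1, h2, -⟩ hg
    have hb := optionToP1_bijective (AlgebraicClosure K)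
    have hfin (i : Fin 3) : ∃ t, optionToP1 _ (some t) = x (i.castLE (by decide)) := by
      obtain ⟨_ | a, ha⟩ := hb.2 (x (i.castLE (by decide)))
      · have hfix := frobP1_optionToP1 (L := AlgebraicClosure K)
          (Fintype.card_ne_zero (α := K)) none
        rw [Option.map_none, ha] at hfix
        fin_cases i <;> simp [h0, h1, h2, hi.eq_iff] at hfix
      · exact ⟨a, ha⟩
    choose t ht using hfin
    refine PGL2_eq_one_of_smul_eq g (t := t) (fun i j hij => ?_) (fun i => ?_)
    · have := hi ((ht i).symm.trans ((congrArg _ (congrArg some hij)).trans (ht j)))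
      simpa using this
    · rw [ht]
      exact congrFun hg _
  have key := card_eq_card_mul_card_orbits_of_free _ hsmul hfree
  have h3 := card_frobP1_iterate_eq_and_ne (K := K) three_ne_zero
  have h2 := card_frobP1_iterate_eq_and_ne (K := K) two_ne_zero
  rw [card_isCycleTuple, card_frobP1_eq] at key
  simp only [Function.iterate_succ, Function.iterate_zero, Function.comp_apply, id_eq] at h3 h2
  rw [h3, h2] at key
  have hG := card_PGL2_mul (K := K)
  have hc := Fintype.one_lt_card (α := K)
  change ((Nat.card (Quotient (Setoid.comap
    (Subtype.val : {x // IsCycleTuple (frobP1 (Fintype.card K)) x} → _)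
    (MulAction.orbitRel (PGL2 K) _))) : ℕ) : ℤ) = _
  generalize Nat.card (PGL2 K) = G at key hG
  generalize Nat.card (Quotient _) = N at key ⊢
  generalize Fintype.card K = q at *
  zify [hc.le, Nat.le_self_pow two_ne_zero q, Nat.le_self_pow three_ne_zero q,
    Nat.one_le_pow 2 q (by omega)] at key hG hc
  have hG' : (G : ℤ) = q ^ 3 - q :=
    mul_right_cancel₀ (sub_ne_zero.2 hc.ne') (by linear_combination hG)
  have hpos : (G : ℤ) ≠ 0 := by
    rw [hG']
    nlinarith [mul_pos (show (0 : ℤ) < q by omega) (show (0 : ℤ) < q ^ 2 - 1 by nlinarith)]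
  refine mul_left_cancel₀ hpos ?_
  rw [← key, hG']
  ring
end

section
/- Let q be a prime power, K a finite field with q elements, K̄ an algebraic closure of K, and φ the Frobenius map on P¹(K̄) given by [a : b] ↦ [a^q : b^q]. The number of orbits of the componentwise action of PGL₂(K) on the set of ordered 6-tuples (x₁, …, x₆) of pairwise distinct points of P¹(K̄) satisfying φ(x₁) = x₂, φ(x₂) = x₃, φ(x₃) = x₄, φ(x₄) = x₅, φ(x₅) = x₁ and φ(x₆) = x₆ equals q³ + q² + q + 1. -/
open Projectivization

namespace FrobeniusTuples

section Coordinates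

variable {L : Type*} [Field L]

/-- The point `[t : 1]` of the projective line. -/
def affinePoint (t : L) : Projectivization L (Fin 2 → L) :=
  Projectivization.mk L ![t, 1] fun h => one_ne_zero (congrFun h 1)

variable (L) in
/-- The point `[1 : 0]` of the projective line. -/
def infinity : Projectivization L (Fin 2 → L) :=
  Projectivization.mk L ![1, 0] fun h => one_ne_zero (congrFun h 0)

theorem affinePoint_injective : Function.Injective (affinePoint : L → _) := by
  intro s t h
  obtain ⟨a, ha⟩ := (Projectivization.mk_eq_mk_iff' _ _ _ _ _).mp h
  have h0 := congrFun ha 0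
  have h1 := congrFun ha 1
  simp at h0 h1
  simpa [h1] using h0.symm

theorem affinePoint_ne_infinity (t : L) : affinePoint t ≠ infinity L := by
  intro h
  obtain ⟨a, ha⟩ := (Projectivization.mk_eq_mk_iff' _ _ _ _ _).mp h
  simpa using congrFun ha 1

theorem eq_infinity_or_exists_affinePoint (x : Projectivization L (Fin 2 → L)) :
    x = infinity L ∨ ∃ t, x = affinePoint t := by
  induction x using Projectivization.ind with
  | h v hv =>
    by_cases h1 : v 1 = 0
    · left
      refine (Projectivization.mk_eq_mk_iff' _ _ _ _ _).mpr ⟨v 0, ?_⟩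
      ext i
      fin_cases i <;> simp [h1]
    · right
      refine ⟨v 0 / v 1, (Projectivization.mk_eq_mk_iff' _ _ _ _ _).mpr ⟨v 1, ?_⟩⟩
      ext i
      fin_cases i <;> simp [mul_div_cancel₀, h1]

theorem frobP1_mk (q : ℕ) (v : Fin 2 → L) (hv : v ≠ 0) (hv' : (fun i => v i ^ q) ≠ 0) :
    frobP1 q (Projectivization.mk L v hv) = Projectivization.mk L (fun i => v i ^ q) hv' := by
  obtain ⟨a, ha⟩ := Projectivization.exists_smul_eq_mk_rep L v hv
  refine (Projectivization.mk_eq_mk_iff' _ _ _ _ _).mpr ⟨(a : L) ^ q, ?_⟩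
  ext i
  simp [← ha, Units.smul_def, mul_pow]

theorem frobP1_affinePoint (q : ℕ) (t : L) :
    frobP1 q (affinePoint t) = affinePoint (t ^ q) := by
  have key : (fun i => (![t, 1] : Fin 2 → L) i ^ q) = ![t ^ q, 1] := by
    ext i
    fin_cases i <;> simp
  have hne : (fun i => (![t, 1] : Fin 2 → L) i ^ q) ≠ 0 := fun h =>
    one_ne_zero (α := L) (by simpa using congrFun h 1)
  rw [affinePoint, frobP1_mk q _ _ hne]
  simp only [key, affinePoint]

theorem frobP1_infinity {q : ℕ} (hq : q ≠ 0) : frobP1 q (infinity L) = infinity L := by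
  have key : (fun i => (![1, 0] : Fin 2 → L) i ^ q) = ![1, 0] := by
    ext i
    fin_cases i <;> simp [hq]
  have hne : (fun i => (![1, 0] : Fin 2 → L) i ^ q) ≠ 0 := fun h =>
    one_ne_zero (α := L) (by simpa using congrFun h 0)
  rw [infinity, frobP1_mk q _ _ hne]
  simp only [key]

end Coordinates

section Action

variable {K : Type*} [Field K]

local notation "L" => AlgebraicClosure K

theorem mulVec_map_ne_zero (g : GL (Fin 2) K) {v : Fin 2 → L} (hv : v ≠ 0) :
    ((g : Matrix (Fin 2) (Fin 2) K).map (algebraMap K L)).mulVec v ≠ 0 := by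
  intro h
  refine hv ((glMulEquiv L (Matrix.GeneralLinearGroup.map (algebraMap K L) g)).injective ?_)
  rw [glMulEquiv_apply, map_zero]
  exact h

theorem coe_smul_mk (g : GL (Fin 2) K) (v : Fin 2 → L) (hv : v ≠ 0) :
    (g : PGL2 K) • Projectivization.mk L v hv =
      Projectivization.mk L (((g : Matrix (Fin 2) (Fin 2) K).map (algebraMap K L)).mulVec v)
        (mulVec_map_ne_zero g hv) := by
  refine (Projectivization.mk_eq_mk_iff' _ _ _ _ _).mpr ⟨1, ?_⟩
  rw [one_smul]
  exact (glMulEquiv_apply L (Matrix.GeneralLinearGroup.map (algebraMap K L) g) v).symm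

theorem coe_smul_affinePoint_eq_infinity_iff (g : GL (Fin 2) K) (t : L) :
    (g : PGL2 K) • affinePoint t = infinity L ↔
      algebraMap K L (g 1 0) * t + algebraMap K L (g 1 1) = 0 := by
  rw [affinePoint, coe_smul_mk, infinity, Projectivization.mk_eq_mk_iff']
  constructor
  · rintro ⟨a, ha⟩
    simpa [Matrix.mulVec, dotProduct, Fin.sum_univ_two] using (congrFun ha 1).symm
  · intro h
    refine ⟨algebraMap K L (g 0 0) * t + algebraMap K L (g 0 1), ?_⟩
    ext i
    fin_cases i <;> simp [Matrix.mulVec, dotProduct, Fin.sum_univ_two, h]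

theorem coe_smul_infinity_eq_infinity_iff (g : GL (Fin 2) K) :
    (g : PGL2 K) • infinity L = infinity L ↔ g 1 0 = 0 := by
  rw [infinity, coe_smul_mk, Projectivization.mk_eq_mk_iff']
  constructor
  · rintro ⟨a, ha⟩
    simpa [Matrix.mulVec, dotProduct, Fin.sum_univ_two] using (congrFun ha 1).symm
  · intro h
    refine ⟨algebraMap K L (g 0 0), ?_⟩
    ext i
    fin_cases i <;> simp [Matrix.mulVec, dotProduct, Fin.sum_univ_two, h]

theorem coe_smul_affinePoint_eq_affinePoint_iff (g : GL (Fin 2) K) (s t : L) :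
    (g : PGL2 K) • affinePoint s = affinePoint t ↔
      (algebraMap K L (g 1 0) * s + algebraMap K L (g 1 1)) * t =
        algebraMap K L (g 0 0) * s + algebraMap K L (g 0 1) := by
  rw [affinePoint, coe_smul_mk, affinePoint, Projectivization.mk_eq_mk_iff']
  constructor
  · rintro ⟨a, ha⟩
    have h0 := congrFun ha 0
    have h1 := congrFun ha 1
    simp [Matrix.mulVec, dotProduct, Fin.sum_univ_two] at h0 h1
    rw [← h0, ← h1]
  · intro h
    refine ⟨algebraMap K L (g 1 0) * s + algebraMap K L (g 1 1), ?_⟩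
    ext i
    fin_cases i <;> simp [Matrix.mulVec, dotProduct, Fin.sum_univ_two, h]

theorem exists_smul_eq_affine (a : Kˣ) (b : K) :
    ∃ g : PGL2 K, g • infinity L = infinity L ∧
      ∀ t : L, g • affinePoint t =
        affinePoint (algebraMap K L a * t + algebraMap K L b) := by
  refine ⟨(Matrix.GeneralLinearGroup.mkOfDetNeZero !![(a : K), b; 0, 1] (by simp) :
    GL (Fin 2) K), ?_, fun t => ?_⟩
  · rw [coe_smul_infinity_eq_infinity_iff]
    simp [Matrix.GeneralLinearGroup.mkOfDetNeZero]
  · rw [coe_smul_affinePoint_eq_affinePoint_iff]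
    simp [Matrix.GeneralLinearGroup.mkOfDetNeZero]

theorem exists_affine_of_smul_eq {g : PGL2 K} (h : g • infinity L = infinity L) {s t : L}
    (hst : g • affinePoint s = affinePoint t) :
    ∃ (a : Kˣ) (b : K), t = algebraMap K L a * s + algebraMap K L b := by
  induction g using QuotientGroup.induction_on with
  | H g =>
    rw [coe_smul_infinity_eq_infinity_iff] at h
    rw [coe_smul_affinePoint_eq_affinePoint_iff, h] at hst
    have hdet : (g : Matrix (Fin 2) (Fin 2) K).det ≠ 0 :=
      Matrix.GeneralLinearGroup.det_ne_zero g
    rw [Matrix.det_fin_two, h, mul_zero, sub_zero] at hdet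
    have h0 : g 0 0 ≠ 0 := left_ne_zero_of_mul hdet
    have h1 : g 1 1 ≠ 0 := right_ne_zero_of_mul hdet
    have h1' : algebraMap K L (g 1 1) ≠ 0 := by simpa using h1
    refine ⟨Units.mk0 (g 0 0 / g 1 1) (div_ne_zero h0 h1), g 0 1 / g 1 1, ?_⟩
    simp only [map_zero, zero_mul, zero_add] at hst
    simp only [Units.val_mk0, map_div₀]
    field_simp
    linear_combination hst

theorem exists_smul_algebraMap_eq_infinity (a : K) :
    ∃ g : PGL2 K, g • affinePoint (algebraMap K L a) = infinity L := by
  refine ⟨(Matrix.GeneralLinearGroup.mkOfDetNeZero !![0, 1; 1, -a] (by simp) :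
    GL (Fin 2) K), ?_⟩
  rw [coe_smul_affinePoint_eq_infinity_iff]
  simp [Matrix.GeneralLinearGroup.mkOfDetNeZero]

end Action

section Frobenius

variable {K : Type*} [Field K] [Fintype K]

local notation "L" => AlgebraicClosure K
local notation "q" => Fintype.card K

theorem frobP1_smul (g : PGL2 K) (x : Projectivization L (Fin 2 → L)) :
    frobP1 q (g • x) = g • frobP1 q x := by
  induction g using QuotientGroup.induction_on with
  | H g =>
    induction x using Projectivization.ind with
    | h v hv =>
      have hne : ∀ {w : Fin 2 → L}, w ≠ 0 → (fun i => w i ^ q) ≠ 0 := fun hw h =>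
        hw (funext fun i => eq_zero_of_pow_eq_zero (congrFun h i))
      rw [coe_smul_mk, frobP1_mk _ _ _ (hne (mulVec_map_ne_zero g hv)),
        frobP1_mk _ _ _ (hne hv), coe_smul_mk, Projectivization.mk_eq_mk_iff']
      refine ⟨1, ?_⟩
      ext i
      have key := map_sum (FiniteField.frobeniusAlgHom K L)
        (fun j => algebraMap K L (g i j) * v j) Finset.univ
      simp only [map_mul, AlgHom.commutes, FiniteField.coe_frobeniusAlgHom] at key
      rw [one_smul]
      simpa only [Matrix.mulVec, dotProduct, Matrix.map_apply] using key.symm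

theorem ncard_setOf_pow_eq {n : ℕ} (hn : n ≠ 0) :
    {t : L | t ^ q ^ n = t}.ncard = q ^ n := by
  obtain ⟨p, hp⟩ := CharP.exists K
  have : CharP L p := charP_of_injective_algebraMap (algebraMap K L).injective p
  have hpq : p ∣ q ^ n :=
    dvd_pow ((CharP.cast_eq_zero_iff K p _).mp (FiniteField.cast_card_eq_zero K)) hn
  have hq : 1 < q ^ n := Nat.one_lt_pow hn Fintype.one_lt_card
  have hcard := Polynomial.card_rootSet_eq_natDegree (K := L)
    (galois_poly_separable (K := L) p (q ^ n) hpq) (IsAlgClosed.splits _)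
  rw [FiniteField.X_pow_card_sub_X_natDegree_eq _ hq, ← Nat.card_eq_fintype_card,
    Nat.card_coe_set_eq] at hcard
  refine Eq.trans (congrArg Set.ncard ?_) hcard
  ext t
  rw [Polynomial.mem_rootSet]
  simp [FiniteField.X_pow_card_sub_X_ne_zero L hq, sub_eq_zero]

theorem finite_setOf_pow_eq {n : ℕ} (hn : n ≠ 0) : {t : L | t ^ q ^ n = t}.Finite :=
  Set.finite_of_ncard_ne_zero <| by
    rw [ncard_setOf_pow_eq hn]
    exact pow_ne_zero _ Fintype.card_ne_zero

theorem pow_card_eq_iff {t : L} : t ^ q = t ↔ ∃ a : K, algebraMap K L a = t := by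
  have h : Set.range (algebraMap K L) = {t : L | t ^ q ^ 1 = t} := by
    refine Set.eq_of_subset_of_ncard_le ?_ ?_ (finite_setOf_pow_eq one_ne_zero)
    · rintro _ ⟨a, rfl⟩
      simp [← map_pow, FiniteField.pow_card]
    · rw [ncard_setOf_pow_eq one_ne_zero, pow_one, ← Set.image_univ,
        Set.ncard_image_of_injective _ (algebraMap K L).injective, Set.ncard_univ,
        Nat.card_eq_fintype_card]
  have := Set.ext_iff.mp h t
  simpa using this.symm

variable (K) in
/-- The elements of degree five over `K`. -/
def degreeFive : Set L := {t | t ^ q ^ 5 = t ∧ t ^ q ≠ t}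

theorem ncard_degreeFive : (degreeFive K).ncard + q = q ^ 5 := by
  have h : degreeFive K = {t : L | t ^ q ^ 5 = t} \ {t : L | t ^ q ^ 1 = t} := by
    ext t
    simp [degreeFive]
  have hsub : {t : L | t ^ q ^ 1 = t} ⊆ {t : L | t ^ q ^ 5 = t} := by
    intro t ht
    rw [Set.mem_ofPred_eq, pow_one, pow_card_eq_iff] at ht
    obtain ⟨a, rfl⟩ := ht
    simp [← map_pow, FiniteField.pow_card_pow]
  have hcard := Set.ncard_sdiff_add_ncard_of_subset hsub (finite_setOf_pow_eq (by simp))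
  rwa [← h, ncard_setOf_pow_eq one_ne_zero, ncard_setOf_pow_eq (by simp), pow_one] at hcard

theorem affine_pow (a b : K) (t : L) (n : ℕ) :
    (algebraMap K L a * t + algebraMap K L b) ^ q ^ n =
      algebraMap K L a * t ^ q ^ n + algebraMap K L b := by
  induction n with
  | zero => simp
  | succ n ih =>
    have key := map_add (FiniteField.frobeniusAlgHom K L)
      (algebraMap K L a * t ^ q ^ n) (algebraMap K L b)
    simp only [map_mul, AlgHom.commutes, FiniteField.coe_frobeniusAlgHom] at key
    rw [pow_succ, pow_mul, ih, key, pow_mul]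

theorem affine_mem_degreeFive (a : Kˣ) (b : K) {t : L} (ht : t ∈ degreeFive K) :
    algebraMap K L a * t + algebraMap K L b ∈ degreeFive K := by
  refine ⟨by rw [affine_pow, ht.1], ?_⟩
  have h := affine_pow (a : K) b t 1
  rw [pow_one] at h
  rw [h]
  simpa using ht.2

theorem affine_injective {t : L} (ht : t ∈ degreeFive K) {a a' : Kˣ} {b b' : K}
    (h : algebraMap K L a * t + algebraMap K L b =
      algebraMap K L a' * t + algebraMap K L b') : a = a' ∧ b = b' := by
  have ha : (a : K) = a' := by
    by_contra hne
    have hne' : algebraMap K L a - algebraMap K L a' ≠ 0 :=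
      sub_ne_zero.mpr fun h => hne ((algebraMap K L).injective h)
    refine ht.2 (pow_card_eq_iff.mpr ⟨(b' - b) / (a - a'), ?_⟩)
    rw [map_div₀, map_sub, map_sub, div_eq_iff hne']
    linear_combination -h
  refine ⟨Units.ext ha, (algebraMap K L).injective ?_⟩
  rw [ha] at h
  exact add_left_cancel h

end Frobenius

section Tuples

variable {K : Type*} [Field K] [Fintype K]

local notation "L" => AlgebraicClosure K
local notation "q" => Fintype.card K

/-- The tuples counted in the main theorem: a Frobenius orbit of length five followed by a
fixed point. -/
def IsFrobeniusTuple (x : Fin 6 → Projectivization L (Fin 2 → L)) : Prop :=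
  Function.Injective x ∧ frobP1 q (x 0) = x 1 ∧ frobP1 q (x 1) = x 2 ∧
    frobP1 q (x 2) = x 3 ∧ frobP1 q (x 3) = x 4 ∧ frobP1 q (x 4) = x 0 ∧
    frobP1 q (x 5) = x 5

theorem IsFrobeniusTuple.smul {x : Fin 6 → Projectivization L (Fin 2 → L)}
    (hx : IsFrobeniusTuple x) (g : PGL2 K) : IsFrobeniusTuple (g • x) := by
  obtain ⟨hinj, h⟩ := hx
  refine ⟨(MulAction.injective g).comp hinj, ?_⟩
  simp only [Pi.smul_apply, frobP1_smul, h, and_self]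

theorem IsFrobeniusTuple.ext {x y : Fin 6 → Projectivization L (Fin 2 → L)}
    (hx : IsFrobeniusTuple x) (hy : IsFrobeniusTuple y) (h0 : x 0 = y 0) (h5 : x 5 = y 5) :
    x = y := by
  obtain ⟨-, hx0, hx1, hx2, hx3, -⟩ := hx
  obtain ⟨-, hy0, hy1, hy2, hy3, -⟩ := hy
  ext i
  fin_cases i <;> simp [← hx0, ← hy0, ← hx1, ← hy1, ← hx2, ← hy2, ← hx3, ← hy3, h0, h5]

/-- The tuple `(t, t ^ q, t ^ q ^ 2, t ^ q ^ 3, t ^ q ^ 4, ∞)`. -/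
noncomputable def standardTuple (t : L) : Fin 6 → Projectivization L (Fin 2 → L) :=
  fun i => if i = 5 then infinity L else affinePoint (t ^ q ^ (i : ℕ))

theorem pow_injOn_of_mem_degreeFive {t : L} (ht : t ∈ degreeFive K) :
    Set.InjOn (fun n : ℕ => t ^ q ^ n) (Set.Iio 5) := by
  have hit (n : ℕ) : (fun s : L => s ^ q)^[n] t = t ^ q ^ n := by
    rw [pow_iterate]
  have : Fact (Nat.Prime 5) := ⟨by norm_num⟩
  have hper : Function.minimalPeriod (fun s : L => s ^ q) t = 5 :=
    Function.minimalPeriod_eq_prime ((hit 5).trans ht.1) ht.2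
  have := Function.iterate_injOn_Iio_minimalPeriod (f := fun s : L => s ^ q) (x := t)
  simpa only [hper, hit] using this

theorem isFrobeniusTuple_standardTuple {t : L} (ht : t ∈ degreeFive K) :
    IsFrobeniusTuple (standardTuple t) := by
  constructor
  · intro i j hij
    by_cases hi : i = 5 <;> by_cases hj : j = 5 <;> simp only [standardTuple, hi, hj, if_true,
      if_false] at hij ⊢
    · exact (affinePoint_ne_infinity _ hij.symm).elim
    · exact (affinePoint_ne_infinity _ hij).elim
    · exact Fin.ext (pow_injOn_of_mem_degreeFive ht (by grind) (by grind)
        (affinePoint_injective hij))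
  · have h := ht.1
    simp [standardTuple, frobP1_affinePoint, frobP1_infinity, ← pow_mul, ← pow_succ, h, ← sq]

theorem exists_smul_eq_standardTuple {x : Fin 6 → Projectivization L (Fin 2 → L)}
    (hx : IsFrobeniusTuple x) :
    ∃ g : PGL2 K, ∃ t ∈ degreeFive K, g • x = standardTuple t := by
  obtain ⟨g, hg⟩ : ∃ g : PGL2 K, g • x 5 = infinity L := by
    rcases eq_infinity_or_exists_affinePoint (x 5) with h | ⟨t, h⟩
    · exact ⟨1, by rw [one_smul, h]⟩
    · have hfix := hx.2.2.2.2.2.2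
      rw [h, frobP1_affinePoint] at hfix
      obtain ⟨a, rfl⟩ := pow_card_eq_iff.mp (affinePoint_injective hfix)
      rw [h]
      exact exists_smul_algebraMap_eq_infinity a
  have hy := hx.smul g
  set y := g • x with hy_def
  have hy5 : y 5 = infinity L := hg
  rcases eq_infinity_or_exists_affinePoint (y 0) with h | ⟨t, h⟩
  · exact absurd (hy.1 (h.trans hy5.symm)) (by decide)
  · have ht : t ∈ degreeFive K := by
      obtain ⟨hinj, h0, h1, h2, h3, h4, -⟩ := hy
      constructor
      · apply affinePoint_injective
        rw [← h2, ← h1, ← h0, h] at h3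
        rw [← h3, h] at h4
        simp only [frobP1_affinePoint, ← pow_mul] at h4
        rw [← h4]
        ring_nf
      · intro hfix
        rw [h, frobP1_affinePoint, hfix, ← h] at h0
        exact absurd (hinj h0) (by decide)
    refine ⟨g, t, ht, hy.ext (isFrobeniusTuple_standardTuple ht) ?_ ?_⟩
    · simp [standardTuple, h]
    · simp [standardTuple, hy5]

theorem exists_smul_standardTuple_eq_iff {s t : L} (hs : s ∈ degreeFive K)
    (ht : t ∈ degreeFive K) :
    (∃ g : PGL2 K, g • standardTuple s = standardTuple t) ↔
      ∃ (a : Kˣ) (b : K), t = algebraMap K L a * s + algebraMap K L b := by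
  constructor
  · rintro ⟨g, hg⟩
    have h0 := congrFun hg 0
    have h5 := congrFun hg 5
    simp only [Pi.smul_apply, standardTuple] at h0 h5
    exact exists_affine_of_smul_eq (g := g) (by simpa using h5) (by simpa using h0)
  · rintro ⟨a, b, rfl⟩
    obtain ⟨g, hg, hga⟩ := exists_smul_eq_affine (K := K) a b
    refine ⟨g, ((isFrobeniusTuple_standardTuple hs).smul g).ext
      (isFrobeniusTuple_standardTuple ht) ?_ ?_⟩
    · simp [standardTuple, hga]
    · simp [standardTuple, hg]

variable (K) in
/-- The orbit relation of `PGL₂(K)` restricted to Frobenius tuples. -/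
noncomputable abbrev frobeniusTupleSetoid :
    Setoid {x : Fin 6 → Projectivization L (Fin 2 → L) // IsFrobeniusTuple x} :=
  Setoid.comap Subtype.val
    (MulAction.orbitRel (PGL2 K) (Fin 6 → Projectivization L (Fin 2 → L)))

theorem card_quotient_mul :
    Nat.card (Quotient (frobeniusTupleSetoid K)) * ((q - 1) * q) + q = q ^ 5 := by
  have hrep (c : Quotient (frobeniusTupleSetoid K)) : ∃ t, ∃ ht : t ∈ degreeFive K,
      c = Quotient.mk _ ⟨standardTuple t, isFrobeniusTuple_standardTuple ht⟩ := by
    induction c using Quotient.inductionOn with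
    | h x =>
      obtain ⟨g, t, ht, h⟩ := exists_smul_eq_standardTuple x.2
      refine ⟨t, ht, (Quotient.sound ?_).symm⟩
      exact MulAction.orbitRel_apply.mpr ⟨g, h⟩
  have hclass {s t : L} (hs : s ∈ degreeFive K) (ht : t ∈ degreeFive K) :
      (Quotient.mk (frobeniusTupleSetoid K)
          ⟨standardTuple t, isFrobeniusTuple_standardTuple ht⟩ =
        Quotient.mk _ ⟨standardTuple s, isFrobeniusTuple_standardTuple hs⟩) ↔
      ∃ (a : Kˣ) (b : K), t = algebraMap K L a * s + algebraMap K L b := by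
    rw [Quotient.eq, ← exists_smul_standardTuple_eq_iff hs ht]
    exact MulAction.orbitRel_apply
  choose rep hrep_mem hrep_eq using hrep
  let f : Quotient (frobeniusTupleSetoid K) × Kˣ × K → degreeFive K := fun c =>
    ⟨_, affine_mem_degreeFive c.2.1 c.2.2 (hrep_mem c.1)⟩
  have hf : Function.Bijective f := by
    constructor
    · rintro ⟨c, a, b⟩ ⟨c', a', b'⟩ h
      have h' : algebraMap K L a * rep c + algebraMap K L b =
        algebraMap K L a' * rep c' + algebraMap K L b' := congrArg Subtype.val h
      have hcc : c = c' := by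
        have h1 := (hclass (hrep_mem c) (affine_mem_degreeFive a b (hrep_mem c))).mpr
          ⟨a, b, rfl⟩
        have h2 := (hclass (hrep_mem c') (affine_mem_degreeFive a b (hrep_mem c))).mpr
          ⟨a', b', h'⟩
        rw [hrep_eq c, hrep_eq c', ← h1, ← h2]
      subst hcc
      obtain ⟨rfl, rfl⟩ := affine_injective (hrep_mem c) h'
      rfl
    · rintro ⟨t, ht⟩
      obtain ⟨a, b, h⟩ := (hclass (hrep_mem _) ht).mp (hrep_eq _)
      exact ⟨⟨_, a, b⟩, Subtype.ext h.symm⟩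
  rw [← ncard_degreeFive, ← Nat.card_coe_set_eq, ← Nat.card_eq_of_bijective f hf, Nat.card_prod,
    Nat.card_prod, Nat.card_units, Nat.card_eq_fintype_card (α := K)]

end Tuples

end FrobeniusTuples

/-- the number of `PGL₂(K)`-orbits of injective 6-tuples on `P¹(K̄)`
satisfying the stated Frobenius conditions. -/
theorem statement12 (q : ℕ) (hq : IsPrimePow q)
    (K : Type*) [Field K] [Fintype K] (hK : Fintype.card K = q) :
    (Nat.card (Quotient (Setoid.comap
      (Subtype.val :
        {x : Fin 6 → Projectivization (AlgebraicClosure K) (Fin 2 → AlgebraicClosure K) //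
          Function.Injective x ∧
          frobP1 q (x 0) = x 1 ∧
          frobP1 q (x 1) = x 2 ∧
          frobP1 q (x 2) = x 3 ∧
          frobP1 q (x 3) = x 4 ∧
          frobP1 q (x 4) = x 0 ∧
          frobP1 q (x 5) = x 5} →
        (Fin 6 → Projectivization (AlgebraicClosure K) (Fin 2 → AlgebraicClosure K)))
      (MulAction.orbitRel (PGL2 K)
        (Fin 6 → Projectivization (AlgebraicClosure K) (Fin 2 → AlgebraicClosure K))))) : ℤ)
    = (q : ℤ) ^ 3 + (q : ℤ) ^ 2 + (q : ℤ) + 1 := by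
  subst hK
  have h := FrobeniusTuples.card_quotient_mul (K := K)
  have hq1 : 1 < Fintype.card K := Fintype.one_lt_card
  change (Nat.card (Quotient (FrobeniusTuples.frobeniusTupleSetoid K)) : ℤ) = _
  generalize Nat.card (Quotient (FrobeniusTuples.frobeniusTupleSetoid K)) = N at h ⊢
  generalize Fintype.card K = m at *
  zify [hq1.le] at h hq1
  have hm : ((m : ℤ) - 1) * m ≠ 0 := mul_ne_zero (by omega) (by omega)
  apply mul_right_cancel₀ hm
  linear_combination h
end
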